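/- arXiv:2105.10229 — 2 statements merged into one kernel-verified Lean document; each statement's English description precedes it below -/
import Mathlib

section
/- Information propagates exactly at shortest-path speed: if j reaches i, then the least k ∈ ℕ with j ∈ X k i equals dist(j,i); consequently, for k < dist(j,i) we have j ∉ X k i, and for k ≥ dist(j,i) we have j ∈ X k i. -/
open scoped Classical

variable {V : Type*}

/-- Walks of length exactly `n`: `stepRel Adj n u v` means there is a directed walk
from `u` to `v` of length `n`. -/
def stepRel (Adj : V → V → Prop) : ℕ → V → V → Prop
  | 0 => Eq
  | (n+1) => fun u v => ∃ w, Adj u w ∧ stepRel Adj n w v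

/-- `ddist Adj u v` is the minimum length of a directed walk from `u` to `v`
(meaningful when `u` reaches `v`). -/
noncomputable def ddist (Adj : V → V → Prop) (u v : V) : ℕ :=
  sInf {n | stepRel Adj n u v}

/-- `reachSet Adj v` is the finite set of vertices that reach `v`. -/
noncomputable def reachSet [Fintype V] (Adj : V → V → Prop) (v : V) : Finset V :=
  Finset.univ.filter (fun u => Relation.ReflTransGen Adj u v)

/-- In-eccentricity: the maximum of `ddist Adj j i` over all `j` reaching `i`. -/
noncomputable def ecc [Fintype V] (Adj : V → V → Prop) (i : V) : ℕ :=
  (Finset.univ.filter (fun j => Relation.ReflTransGen Adj j i)).sup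
    (fun j => ddist Adj j i)

/-- Finite digraph diameter: maximum of `ddist Adj u v` over ordered pairs `(u, v)`
with `u` reaching `v`. -/
noncomputable def fdiam [Fintype V] (Adj : V → V → Prop) : ℕ :=
  (Finset.univ.filter (fun p : V × V => Relation.ReflTransGen Adj p.1 p.2)).sup
    (fun p => ddist Adj p.1 p.2)

/-- Algorithm 1's flooding iteration: `flood Adj 0 i = {i}` and
`flood Adj (k+1) i = flood Adj k i ∪ ⋃_{j with Adj j i} flood Adj k j`. -/
noncomputable def flood [Fintype V] [DecidableEq V] (Adj : V → V → Prop) : ℕ → V → Finset V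
  | 0, i => {i}
  | (k+1), i => flood Adj k i ∪
      (Finset.univ.filter (fun j => Adj j i)).biUnion (fun j => flood Adj k j)

theorem stepRel_succ_iff (Adj : V → V → Prop) (n : ℕ) (u v : V) :
    stepRel Adj (n + 1) u v ↔ ∃ w, stepRel Adj n u w ∧ Adj w v := by
  induction n generalizing u with
  | zero => simp [stepRel]
  | succ n ih =>
    constructor
    · rintro ⟨a, hua, hav⟩
      obtain ⟨w, haw, hwv⟩ := (ih a).1 hav
      exact ⟨w, ⟨a, hua, haw⟩, hwv⟩
    · rintro ⟨w, ⟨a, hua, haw⟩, hwv⟩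
      exact ⟨a, hua, (ih a).2 ⟨w, haw, hwv⟩⟩

theorem exists_stepRel_of_reflTransGen {Adj : V → V → Prop} {u v : V}
    (h : Relation.ReflTransGen Adj u v) : ∃ n, stepRel Adj n u v := by
  induction h with
  | refl => exact ⟨0, rfl⟩
  | tail _ hwv ih =>
    obtain ⟨n, hn⟩ := ih
    exact ⟨n + 1, (stepRel_succ_iff Adj n _ _).2 ⟨_, hn, hwv⟩⟩

theorem mem_flood_iff_exists_stepRel [Fintype V] [DecidableEq V] (Adj : V → V → Prop) (k : ℕ)
    (i j : V) : j ∈ flood Adj k i ↔ ∃ n ≤ k, stepRel Adj n j i := by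
  induction k generalizing i with
  | zero => simp [flood, stepRel]
  | succ k ih =>
    simp only [flood, Finset.mem_union, Finset.mem_biUnion, Finset.mem_filter, Finset.mem_univ,
      true_and, ih]
    constructor
    · rintro (⟨n, hn, h⟩ | ⟨w, hwi, n, hn, h⟩)
      · exact ⟨n, by omega, h⟩
      · exact ⟨n + 1, by omega, (stepRel_succ_iff Adj n j i).2 ⟨w, h, hwi⟩⟩
    · rintro ⟨_ | n, hn, h⟩
      · exact Or.inl ⟨0, by omega, h⟩
      · obtain ⟨w, hjw, hwi⟩ := (stepRel_succ_iff Adj n j i).1 h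
        exact Or.inr ⟨w, hwi, n, by omega, hjw⟩

theorem mem_flood_iff_ddist_le [Fintype V] [DecidableEq V] {Adj : V → V → Prop} {i j : V}
    (h : Relation.ReflTransGen Adj j i) (k : ℕ) :
    j ∈ flood Adj k i ↔ ddist Adj j i ≤ k := by
  rw [mem_flood_iff_exists_stepRel]
  constructor
  · rintro ⟨n, hn, hs⟩
    exact (Nat.sInf_le hs).trans hn
  · exact fun hk => ⟨_, hk, Nat.sInf_mem (exists_stepRel_of_reflTransGen h)⟩

/-- if `j` reaches `i`, the least `k` with `j ∈ X k i` equals `dist(j,i)`;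
for `k < dist(j,i)` we have `j ∉ X k i`, and for `k ≥ dist(j,i)` we have `j ∈ X k i`. -/
theorem stmt2 [Fintype V] [DecidableEq V] (Adj : V → V → Prop) (i j : V)
    (h : Relation.ReflTransGen Adj j i) :
    sInf {k : ℕ | j ∈ flood Adj k i} = ddist Adj j i ∧
    (∀ k < ddist Adj j i, j ∉ flood Adj k i) ∧
    (∀ k ≥ ddist Adj j i, j ∈ flood Adj k i) := by
  simp only [mem_flood_iff_ddist_le h, not_le]
  exact ⟨csInf_Ici, fun _ hk => hk, fun _ hk => hk⟩
end

section
/- Stopping criterion of Lemma 2 (cardinality form): if for some k ∈ ℕ the cardinalities stabilize at every vertex, i.e. |X (k+1) i| = |X k i| for all vertices i, then the iteration has reached its fixed point: X m i = X k i for all m ≥ k and X k i = reach(i) for every vertex i. -/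
open scoped Classical

variable {V : Type*}

theorem mem_flood_succ [Fintype V] [DecidableEq V] (Adj : V → V → Prop) (k : ℕ) (u i : V) :
    u ∈ flood Adj (k + 1) i ↔ u ∈ flood Adj k i ∨ ∃ j, Adj j i ∧ u ∈ flood Adj k j := by
  simp [flood]

theorem flood_subset_flood_succ [Fintype V] [DecidableEq V] (Adj : V → V → Prop) (k : ℕ) (i : V) :
    flood Adj k i ⊆ flood Adj (k + 1) i :=
  fun u hu => (mem_flood_succ Adj k u i).2 (Or.inl hu)

theorem self_mem_flood [Fintype V] [DecidableEq V] (Adj : V → V → Prop) (k : ℕ) (i : V) :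
    i ∈ flood Adj k i := by
  induction k with
  | zero => simp [flood]
  | succ k ih => exact flood_subset_flood_succ Adj k i ih

theorem reflTransGen_of_mem_flood [Fintype V] [DecidableEq V] (Adj : V → V → Prop) (k : ℕ)
    {u i : V} (hu : u ∈ flood Adj k i) : Relation.ReflTransGen Adj u i := by
  induction k generalizing i with
  | zero =>
    obtain rfl : u = i := by simpa [flood] using hu
    exact .refl
  | succ k ih =>
    rcases (mem_flood_succ Adj k u i).1 hu with hu | ⟨j, hj, hu⟩
    · exact ih hu
    · exact (ih hu).tail hj

/-- A stationary flooding step consists of exactly the vertices that reach the base vertex. -/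
theorem flood_eq_reachSet_of_stationary [Fintype V] [DecidableEq V] (Adj : V → V → Prop) (k : ℕ)
    (h : ∀ i, flood Adj (k + 1) i = flood Adj k i) (i : V) :
    flood Adj k i = reachSet Adj i := by
  ext u
  simp only [reachSet, Finset.mem_filter, Finset.mem_univ, true_and]
  refine ⟨reflTransGen_of_mem_flood Adj k, fun hu => ?_⟩
  induction hu with
  | refl => exact self_mem_flood Adj k u
  | @tail j i _ hj ih =>
    rw [← h i]
    exact (mem_flood_succ Adj k u i).2 (Or.inr ⟨j, hj, ih⟩)

theorem flood_eq_of_stationary [Fintype V] [DecidableEq V] (Adj : V → V → Prop) (k : ℕ)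
    (h : ∀ i, flood Adj (k + 1) i = flood Adj k i) {m : ℕ} (hm : k ≤ m) (i : V) :
    flood Adj m i = flood Adj k i := by
  induction m, hm using Nat.le_induction generalizing i with
  | base => rfl
  | succ m _ ih =>
    rw [← h i]
    ext u
    simp only [mem_flood_succ, ih]

/-- stopping criterion, cardinality form: if `|X (k+1) i| = |X k i|`
for all vertices `i`, then `X m i = X k i` for all `m ≥ k` and `X k i = reach(i)`. -/
theorem stmt6 [Fintype V] [DecidableEq V] (Adj : V → V → Prop) (k : ℕ)
    (h : ∀ i : V, (flood Adj (k+1) i).card = (flood Adj k i).card) :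
    (∀ i : V, ∀ m ≥ k, flood Adj m i = flood Adj k i) ∧
    (∀ i : V, flood Adj k i = reachSet Adj i) := by
  have hs : ∀ i, flood Adj (k + 1) i = flood Adj k i := fun i =>
    (Finset.eq_of_subset_of_card_le (flood_subset_flood_succ Adj k i) (h i).le).symm
  exact ⟨fun i _ hm => flood_eq_of_stationary Adj k hs hm i,
    flood_eq_reachSet_of_stationary Adj k hs⟩
end
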